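/- The two coherent group averages coincide: |U_sym|⁻¹ Σ_{U∈U_sym} U = |G|⁻¹ Σ_{g∈G} T_g, and this operator is the orthogonal projection Π_phys of H_N onto the relational subspace H_phys. -/

import Mathlib

noncomputable section

open Matrix

namespace QRF

section Defs

variable (G : Type) [Fintype G] [DecidableEq G] [CommGroup G]

/-- The `K`-particle Hilbert space `ℂ^{G^K}` (as functions `G^K → ℂ`). -/
abbrev Vec (K : ℕ) : Type := (Fin K → G) → ℂ

/-- Linear operators on the `K`-particle Hilbert space. -/
abbrev Op (K : ℕ) : Type := Matrix (Fin K → G) (Fin K → G) ℂ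

variable {G}

/-- The standard basis vector `|x⟩`. -/
def ket {K : ℕ} (x : Fin K → G) : Vec G K := fun y => if y = x then 1 else 0

/-- The global translation `T_g`, `T_g |x₁,…,x_K⟩ = |g x₁, …, g x_K⟩`. -/
def trans {K : ℕ} (g : G) : Op G K :=
  Matrix.of fun x y => if x = (fun i => g * y i) then 1 else 0

/-- The configuration `(g, h₁ g, …, h_k g)`, i.e. `|g, hg⟩`. -/
def cfg {k : ℕ} (h : Fin k → G) (g : G) : Fin (k + 1) → G :=
  Fin.cons g fun i => h i * g

/-- The inner product `⟨v, w⟩` (antilinear in the first argument). -/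
def inn {K : ℕ} (v w : Vec G K) : ℂ := star v ⬝ᵥ w

/-- The rank-one operator `|v⟩⟨w|`. -/
def outer {K : ℕ} (v w : Vec G K) : Op G K :=
  Matrix.of fun x y => v x * (starRingEnd ℂ) (w y)

/-- The matrix element `⟨v|A|w⟩`. -/
def melem {K : ℕ} (v : Vec G K) (A : Op G K) (w : Vec G K) : ℂ :=
  star v ⬝ᵥ A.mulVec w

/-- The Hilbert–Schmidt inner product `⟨A,B⟩ := tr(A† B)`. -/
def hsInner {K : ℕ} (A B : Op G K) : ℂ := (Aᴴ * B).trace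

variable (G)

/-- The symmetry group `U_sym` of relation-conditional global translations
(for `k+1` particles). -/
def Usym (k : ℕ) : Set (Op G (k + 1)) :=
  {U | U ∈ Matrix.unitaryGroup (Fin (k + 1) → G) ℂ ∧
    ∃ c : (Fin k → G) → G, ∀ (h : Fin k → G) (g : G),
      U.mulVec (ket (cfg h g)) = (trans (c h)).mulVec (ket (cfg h g))}

/-- The characters of `G`: monoid homomorphisms `G → ℂ` of modulus one. -/
def Ghat : Type := {χ : G →* ℂ // ∀ g : G, ‖χ g‖ = 1}

/-- The trivial character `𝟙`. -/
instance : One (Ghat G) := ⟨⟨1, fun g => by simp⟩⟩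

variable {G}

/-- The vector `|h;χ⟩ := |G|^{-1/2} ∑_{g ∈ G} χ(g⁻¹) |g, hg⟩`. -/
def relKet {k : ℕ} (h : Fin k → G) (χ : Ghat G) : Vec G (k + 1) :=
  ((Real.sqrt (Fintype.card G) : ℂ))⁻¹ • ∑ g : G, χ.1 g⁻¹ • ket (cfg h g)

variable (G)

/-- The relational subspace `H_phys = span{|h;𝟙⟩}`. -/
def Hphys (k : ℕ) : Submodule ℂ (Vec G (k + 1)) :=
  Submodule.span ℂ {v | ∃ h : Fin k → G, v = relKet h (1 : Ghat G)}

/-- `Π_phys = ∑_h |h;𝟙⟩⟨h;𝟙|`, the orthogonal projection onto `H_phys`. -/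
def Piphys (k : ℕ) : Op G (k + 1) :=
  ∑ h : Fin k → G, outer (relKet h (1 : Ghat G)) (relKet h (1 : Ghat G))

variable {G}

/-- `Π_{h;χ≠𝟙} = ∑_{χ ∈ Ĝ, χ ≠ 𝟙} |h;χ⟩⟨h;χ|`. -/
def PiNot1 {k : ℕ} (h : Fin k → G) : Op G (k + 1) :=
  ∑ᶠ (χ : Ghat G) (_ : χ ≠ 1), outer (relKet h χ) (relKet h χ)

variable (G)

/-- The invariant algebra `A_inv`. -/
def Ainv (k : ℕ) : Set (Op G (k + 1)) :=
  {A | ∀ U ∈ Usym G k, U * A * Uᴴ = A}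

/-- The incoherent group average (twirl) `Π_inv` over `U_sym`. -/
def Piinv (k : ℕ) (ρ : Op G (k + 1)) : Op G (k + 1) :=
  (Nat.card ↥(Usym G k) : ℂ)⁻¹ • ∑ᶠ U ∈ Usym G k, U * ρ * Uᴴ

/-- The algebra `A_phys` of relational observables (operators supported on `H_phys`). -/
def Aphys (k : ℕ) : Set (Op G (k + 1)) :=
  {A | A = Piphys G k * A * Piphys G k}

/-- The algebra `A_alg`. -/
def Aalg (k : ℕ) : Set (Op G (k + 1)) :=
  {X | ∃ B ∈ Aphys G k, ∃ a : (Fin k → G) → ℂ,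
      X = B + ∑ h : Fin k → G, a h • PiNot1 h}

variable {G}

/-- The vector `|e⟩_i ⊗ φ`. -/
def insVec {k : ℕ} (i : Fin (k + 1)) (φ : (Fin k → G) → ℂ) : Vec G (k + 1) :=
  fun x => if x i = 1 then φ (fun j => x (i.succAbove j)) else 0

/-- The operator `|e⟩⟨e|_i ⊗ A`. -/
def eAop {k : ℕ} (i : Fin (k + 1)) (A : Matrix (Fin k → G) (Fin k → G) ℂ) :
    Op G (k + 1) :=
  Matrix.of fun x y =>
    if x i = 1 ∧ y i = 1 then
      A (fun j => x (i.succAbove j)) (fun j => y (i.succAbove j))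
    else 0

/-- `ψ` is `i`-alignable. -/
def IAlignable {k : ℕ} (i : Fin (k + 1)) (ψ : Vec G (k + 1)) : Prop :=
  ∃ (θ : ℝ) (U : Op G (k + 1)) (φ : (Fin k → G) → ℂ),
    U ∈ Usym G k ∧ ψ = Complex.exp (θ * Complex.I) • U.mulVec (insVec i φ)

/-- `ψ` is alignable. -/
def Alignable {k : ℕ} (ψ : Vec G (k + 1)) : Prop := ∃ i, IAlignable i ψ

/-- Symmetry equivalence of state vectors (up to a global phase). -/
def SymmEquiv {k : ℕ} (ψ ψ' : Vec G (k + 1)) : Prop :=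
  ∃ (θ : ℝ) (U : Op G (k + 1)),
    U ∈ Usym G k ∧ ψ' = Complex.exp (θ * Complex.I) • U.mulVec ψ

/-- `P` is the orthogonal projection of operator space onto the set `S`,
with respect to the Hilbert–Schmidt inner product. -/
def IsHSProj {K : ℕ} (S : Set (Op G K)) (P : Op G K →ₗ[ℂ] Op G K) : Prop :=
  (∀ ρ, P ρ ∈ S) ∧ (∀ A ∈ S, P A = A) ∧
    ∀ ρ σ, hsInner (P ρ) σ = hsInner ρ (P σ)

/-- First `n+1` components of an `(n+1)+(m+1)`-particle configuration. -/
def split1 {n m : ℕ} (x : Fin (n + m + 1 + 1) → G) : Fin (n + 1) → G :=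
  fun i => x ⟨i.1, by have := i.2; omega⟩

/-- Last `m+1` components of an `(n+1)+(m+1)`-particle configuration. -/
def split2 {n m : ℕ} (x : Fin (n + m + 1 + 1) → G) : Fin (m + 1) → G :=
  fun i => x ⟨n + 1 + i.1, by have := i.2; omega⟩

/-- The tensor product `A ⊗ B` of operators, under the identification
`H_{N+M} ≅ H_N ⊗ H_M`, `|x,y⟩ ↦ |x⟩ ⊗ |y⟩`. -/
def tensorOp {n m : ℕ} (A : Op G (n + 1)) (B : Op G (m + 1)) :
    Op G (n + m + 1 + 1) :=
  Matrix.of fun x y => A (split1 x) (split1 y) * B (split2 x) (split2 y)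

/-- Concatenation `(h, g⃗)` of relation tuples. -/
def relcat {n m : ℕ} (h : Fin n → G) (gv : Fin (m + 1) → G) :
    Fin (n + m + 1) → G :=
  (Fin.append h gv : Fin (n + (m + 1)) → G)

/-- Joining of configurations `(x, z)`. -/
def join {n m : ℕ} (x : Fin (n + 1) → G) (z : Fin (m + 1) → G) :
    Fin (n + m + 1 + 1) → G :=
  fun i => if hi : i.1 < n + 1 then x ⟨i.1, hi⟩
           else z ⟨i.1 - (n + 1), by have := i.2; omega⟩

/-- The standard partial trace over the last `m+1` particles. -/
def ptraceM {n m : ℕ} (ρ : Op G (n + m + 1 + 1)) : Op G (n + 1) :=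
  Matrix.of fun x y => ∑ z : Fin (m + 1) → G, ρ (join x z) (join y z)

end Defs

theorem mulVec_ket {G : Type} [Fintype G] [DecidableEq G] {K : ℕ} (A : Op G K) (y : Fin K → G) :
    A.mulVec (ket y) = fun x => A x y := by
  funext x
  simp [Matrix.mulVec, dotProduct, ket]

/-- Evaluation at a point pushes the uniform average over functions `α → G` forward to the
uniform average over `G`. -/
theorem card_mul_sum_eval {G α : Type} [Fintype G] [Group G] [Fintype α] [DecidableEq α]
    (f : G → ℂ) (a : α) :
    (Fintype.card G : ℂ) * ∑ c : α → G, f (c a) =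
      (Fintype.card (α → G) : ℂ) * ∑ g, f g := by
  calc (Fintype.card G : ℂ) * ∑ c : α → G, f (c a)
      = ∑ g : G, ∑ c : α → G, f (c a) := by simp
    _ = ∑ g : G, ∑ c : α → G, f (g * c a) := by
        refine Finset.sum_congr rfl fun g _ => ?_
        exact (Equiv.sum_comp (Equiv.mulLeft (fun _ : α => g)) fun c : α → G => f (c a)).symm
    _ = ∑ c : α → G, ∑ g, f (g * c a) := Finset.sum_comm
    _ = ∑ c : α → G, ∑ g, f g :=
        Finset.sum_congr rfl fun c _ => Equiv.sum_comp (Equiv.mulRight (c a)) f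
    _ = _ := by simp

section Averages

variable {G : Type} [CommGroup G] {k : ℕ}

/-- The relations `(x₁ x₀⁻¹, …, x_k x₀⁻¹)` of a configuration. -/
def relations (x : Fin (k + 1) → G) : Fin k → G := fun i => x i.succ * (x 0)⁻¹

theorem cfg_relations (x : Fin (k + 1) → G) : cfg (relations x) (x 0) = x := by
  funext i
  refine Fin.cases ?_ (fun j => ?_) i <;> simp [cfg, relations]

theorem relations_cfg (h : Fin k → G) (g : G) : relations (cfg h g) = h := by
  funext i
  simp [cfg, relations]

theorem mul_cfg (h : Fin k → G) (a g : G) : (fun i => a * cfg h g i) = cfg h (a * g) := by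
  funext i
  refine Fin.cases ?_ (fun j => ?_) i
  · simp [cfg]
  · simp [cfg, mul_left_comm]

theorem relations_mul (a : G) (x : Fin (k + 1) → G) :
    relations (fun i => a * x i) = relations x := by
  rw [← cfg_relations x, mul_cfg, relations_cfg, relations_cfg]

theorem condShift_injective (c : (Fin k → G) → G) :
    Function.Injective fun (y : Fin (k + 1) → G) i => c (relations y) * y i := by
  intro y z hyz
  have hr : relations y = relations z := by
    rw [← relations_mul (c (relations y)) y, ← relations_mul (c (relations z)) z]
    exact congrArg relations hyz
  funext i
  have := congrFun hyz i
  simpa [hr] using this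

variable [DecidableEq G]

/-- The translation by `c(h)` conditional on the relations `h`. -/
def condTrans (c : (Fin k → G) → G) : Op G (k + 1) :=
  Matrix.of fun x y => if x = (fun i => c (relations y) * y i) then 1 else 0

theorem condTrans_injective :
    Function.Injective (condTrans : ((Fin k → G) → G) → Op G (k + 1)) := by
  intro c d hcd
  funext h
  have := congrFun (congrFun hcd (cfg h (c h))) (cfg h 1)
  simp only [condTrans, Matrix.of_apply, relations_cfg, mul_cfg, mul_one, if_true] at this
  by_contra hne
  rw [if_neg] at this
  · exact one_ne_zero this
  · intro heq
    exact hne (by simpa [cfg] using congrFun heq 0)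

theorem conjTranspose_trans {K : ℕ} (g : G) : (trans g : Op G K)ᴴ = trans g⁻¹ := by
  ext x y
  have : y = (fun i => g * x i) ↔ x = (fun i => g⁻¹ * y i) := by
    simp only [funext_iff, eq_inv_mul_iff_mul_eq]
    exact forall_congr' fun i => eq_comm
  simp [trans, Matrix.conjTranspose_apply, apply_ite, this]

variable [Fintype G]

theorem condTrans_mem_unitaryGroup (c : (Fin k → G) → G) :
    condTrans c ∈ Matrix.unitaryGroup (Fin (k + 1) → G) ℂ := by
  rw [Matrix.mem_unitaryGroup_iff', Matrix.star_eq_conjTranspose]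
  ext x y
  have := (condShift_injective c).eq_iff (a := y) (b := x)
  simp [Matrix.mul_apply, Matrix.conjTranspose_apply, condTrans, Matrix.one_apply, apply_ite, this,
    eq_comm (a := y)]

theorem Usym_eq_range : Usym G k = Set.range condTrans := by
  ext U
  constructor
  · rintro ⟨-, c, hc⟩
    refine ⟨c, ?_⟩
    ext x y
    have := congrFun (hc (relations y) (y 0)) x
    rw [cfg_relations, mulVec_ket, mulVec_ket] at this
    exact this.symm
  · rintro ⟨c, rfl⟩
    refine ⟨condTrans_mem_unitaryGroup c, c, fun h g => ?_⟩
    rw [mulVec_ket, mulVec_ket]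
    funext x
    simp [condTrans, trans, relations_cfg]

theorem average_Usym_eq_average_trans :
    (Nat.card ↥(Usym G k) : ℂ)⁻¹ • (∑ᶠ U ∈ Usym G k, U) =
      (Fintype.card G : ℂ)⁻¹ • ∑ g : G, (trans g : Op G (k + 1)) := by
  rw [Usym_eq_range, finsum_mem_range condTrans_injective, finsum_eq_sum_of_fintype,
    Nat.card_range_of_injective condTrans_injective, Nat.card_eq_fintype_card]
  ext x y
  have key := card_mul_sum_eval
    (fun g : G => if x = (fun i => g * y i) then (1 : ℂ) else 0) (relations y)
  have hG : (Fintype.card G : ℂ) ≠ 0 := Nat.cast_ne_zero.mpr Fintype.card_ne_zero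
  have hC : (Fintype.card ((Fin k → G) → G) : ℂ) ≠ 0 :=
    Nat.cast_ne_zero.mpr Fintype.card_ne_zero
  simp only [Matrix.smul_apply, Matrix.sum_apply, condTrans, trans, Matrix.of_apply, smul_eq_mul]
  rw [inv_mul_eq_div, inv_mul_eq_div, div_eq_div_iff hC hG, mul_comm, key, mul_comm]

theorem trans_mul_trans {K : ℕ} (g h : G) :
    (trans g * trans h : Op G K) = trans (g * h) := by
  ext x y
  simp [trans, Matrix.mul_apply, mul_assoc]

theorem conjTranspose_average_trans {K : ℕ} :
    ((Fintype.card G : ℂ)⁻¹ • ∑ g : G, (trans g : Op G K))ᴴ =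
      (Fintype.card G : ℂ)⁻¹ • ∑ g : G, trans g := by
  rw [Matrix.conjTranspose_smul, Matrix.conjTranspose_sum]
  simp only [conjTranspose_trans, star_inv₀, star_natCast]
  exact congrArg _ (Equiv.sum_comp (Equiv.inv G) fun g => (trans g : Op G K))

theorem average_trans_mul_self {K : ℕ} :
    ((Fintype.card G : ℂ)⁻¹ • ∑ g : G, (trans g : Op G K)) *
        ((Fintype.card G : ℂ)⁻¹ • ∑ g : G, trans g) =
      (Fintype.card G : ℂ)⁻¹ • ∑ g : G, trans g := by
  have hG : (Fintype.card G : ℂ) ≠ 0 := Nat.cast_ne_zero.mpr Fintype.card_ne_zero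
  have hsum : (∑ g : G, (trans g : Op G K)) * ∑ g : G, trans g =
      (Fintype.card G : ℂ) • ∑ g : G, trans g := by
    simp only [Finset.sum_mul, Finset.mul_sum, trans_mul_trans]
    rw [Finset.sum_comm]
    simp only [fun g => Equiv.sum_comp (Equiv.mulLeft g) fun h => (trans h : Op G K),
      ← Equiv.coe_mulLeft]
    simp [Nat.cast_smul_eq_nsmul]
  rw [smul_mul_smul_comm, hsum, smul_smul, mul_assoc, inv_mul_cancel₀ hG, mul_one]

theorem average_trans_col_cfg (h : Fin k → G) (a : G) :
    ((Fintype.card G : ℂ)⁻¹ • ∑ g : G, (trans g : Op G (k + 1))).col (cfg h a) =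
      (Real.sqrt (Fintype.card G) : ℂ)⁻¹ • relKet h 1 := by
  have hs : (Real.sqrt (Fintype.card G) : ℂ) * Real.sqrt (Fintype.card G) = Fintype.card G := by
    rw [← Complex.ofReal_mul, Real.mul_self_sqrt (Nat.cast_nonneg _), Complex.ofReal_natCast]
  have hone : ∀ g : G, (1 : Ghat G).1 g = 1 := fun _ => rfl
  funext x
  simp only [relKet, smul_smul, ← mul_inv, hs, Matrix.col_apply, Matrix.smul_apply,
    Matrix.sum_apply, trans, Matrix.of_apply, mul_cfg, hone, one_smul, Pi.smul_apply,
    Finset.sum_apply, ket]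
  congr 1
  exact Equiv.sum_comp (Equiv.mulRight a) fun g => if x = cfg h g then (1 : ℂ) else 0

theorem range_average_trans :
    LinearMap.range
        ((Fintype.card G : ℂ)⁻¹ • ∑ g : G, (trans g : Op G (k + 1))).mulVecLin =
      Hphys G k := by
  have hs : (Real.sqrt (Fintype.card G) : ℂ) ≠ 0 := by
    rw [Complex.ofReal_ne_zero, Real.sqrt_ne_zero']
    exact Nat.cast_pos.mpr Fintype.card_pos
  rw [Matrix.range_mulVecLin]
  apply le_antisymm
  · rw [Submodule.span_le]
    rintro _ ⟨y, rfl⟩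
    rw [← cfg_relations y, average_trans_col_cfg]
    exact Submodule.smul_mem _ _ (Submodule.subset_span ⟨_, rfl⟩)
  · rw [Hphys, Submodule.span_le]
    rintro _ ⟨h, rfl⟩
    rw [← smul_inv_smul₀ hs (relKet h 1), ← average_trans_col_cfg h 1]
    exact Submodule.smul_mem _ _ (Submodule.subset_span ⟨_, rfl⟩)

end Averages

/-- The coherent group average over `U_sym` equals the coherent group
average over the global translations, and this operator is the orthogonal projection
of `H_N` onto the relational subspace `H_phys` (it is Hermitian, idempotent, and its
range is `H_phys`). -/
theorem stmt3 (G : Type) [Fintype G] [DecidableEq G] [CommGroup G] (n : ℕ) :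
    ((Nat.card ↥(Usym G n) : ℂ)⁻¹ • (∑ᶠ U ∈ Usym G n, U) =
      (Fintype.card G : ℂ)⁻¹ • ∑ g : G, (trans g : Op G (n + 1))) ∧
    ∀ P : Op G (n + 1),
      P = (Fintype.card G : ℂ)⁻¹ • ∑ g : G, (trans g : Op G (n + 1)) →
      Pᴴ = P ∧ P * P = P ∧ LinearMap.range P.mulVecLin = Hphys G n := by
  refine ⟨average_Usym_eq_average_trans, ?_⟩
  rintro P rfl
  exact ⟨conjTranspose_average_trans, average_trans_mul_self, range_average_trans⟩

end QRF

end
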